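/- arXiv:0704.0416 — 4 statements merged into one kernel-verified Lean document; each statement's English description precedes it below -/
import Mathlib

section
/- Let U be a finite index subgroup of F₂ satisfying Property B. Then for every n ≥ 1, Γ(Hₙ) ⊆ Γ(U), and for all n, m ≥ 1 with n dividing m, Γ(H_m) ⊆ Γ(Hₙ). In particular, if Γ(U) is not a congruence subgroup of SL₂(ℤ), then for every n ≥ 1 the group Γ(Hₙ) is not a congruence subgroup of SL₂(ℤ). -/
/-- The free group on two generators. -/
abbrev F2 := FreeGroup (Fin 2)

/-- The generator `x` of `F₂`. -/
def xg : F2 := FreeGroup.of 0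

/-- The generator `y` of `F₂`. -/
def yg : F2 := FreeGroup.of 1

/-- The exponent sum of the `i`-th generator, i.e. the `i`-th coordinate of the image in the
abelianization `ℤ²` of `F₂`. -/
def expSum (i : Fin 2) : F2 →* Multiplicative ℤ :=
  FreeGroup.lift fun j => Multiplicative.ofAdd (if j = i then (1 : ℤ) else 0)

/-- The matrix in `GL₂(ℤ)` induced by an automorphism `γ` of `F₂` on the abelianization
`F₂^ab ≅ ℤ²` (with basis the images of `x` and `y`); i.e. `β̂(γ)`. -/
def autMat (γ : F2 ≃* F2) : Matrix (Fin 2) (Fin 2) ℤ :=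
  Matrix.of fun i j => Multiplicative.toAdd (expSum i (γ (FreeGroup.of j)))

abbrev SL2Z := Matrix.SpecialLinearGroup (Fin 2) ℤ

/-- `Stab(V) = {γ ∈ Aut⁺(F₂) : γ(V) = V}`. -/
def StabSet (V : Subgroup F2) : Set (F2 ≃* F2) :=
  { γ | (autMat γ).det = 1 ∧ Subgroup.map γ.toMonoidHom V = V }

/-- The Veech group `Γ(V) = β̂(Stab(V)) ⊆ SL₂(ℤ)` of a subgroup `V` of `F₂`. -/
def VeechGroup (V : Subgroup F2) : Set SL2Z :=
  { A | ∃ γ : F2 ≃* F2, γ ∈ StabSet V ∧ (A : Matrix (Fin 2) (Fin 2) ℤ) = autMat γ }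

/-- A set of elements of `SL₂(ℤ)` is a congruence group if it contains the principal congruence
subgroup `Γ(n)` for some `n ≥ 1`. -/
def IsCongruenceSet (S : Set SL2Z) : Prop :=
  ∃ n : ℕ, 1 ≤ n ∧ (CongruenceSubgroup.Gamma n : Set SL2Z) ⊆ S

/-- The subgroup of `Multiplicative ℤ` of elements divisible by `n`. -/
def divSub (n : ℤ) : Subgroup (Multiplicative ℤ) where
  carrier := {d | n ∣ Multiplicative.toAdd d}
  one_mem' := dvd_zero n
  mul_mem' := fun ha hb => dvd_add ha hb
  inv_mem' := fun ha => dvd_neg.mpr ha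

/-- The subgroup `Hₙ = {u ∈ U : n ∣ α(u)}` of `F₂` (for `n = 0` this is `ker α = H₀`). -/
def Hgrp {U : Subgroup F2} (α : U →* Multiplicative ℤ) (n : ℕ) : Subgroup F2 :=
  Subgroup.map U.subtype (Subgroup.comap α (divSub (n : ℤ)))

/-- The subgroup `U_L` of `F₂` corresponding to the origami `L(2,3)`. -/
def UL : Subgroup F2 :=
  Subgroup.closure {xg ^ 3, xg * yg * xg⁻¹, xg ^ 2 * yg * (xg ^ 2)⁻¹, yg * xg * yg⁻¹, yg ^ 2}

/-- The subgroup `U_D` of `F₂` corresponding to the origami `D`. -/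
def UD : Subgroup F2 :=
  Subgroup.closure {xg ^ 3, xg * yg * (xg ^ 2)⁻¹, xg ^ 2 * yg * xg⁻¹, yg * xg * yg⁻¹,
    yg ^ 2 * xg * (yg ^ 2)⁻¹, yg ^ 3}

theorem mem_Hgrp {U : Subgroup F2} (α : U →* Multiplicative ℤ) (n : ℕ) (x : F2) :
    x ∈ Hgrp α n ↔ ∃ h : x ∈ U, (n : ℤ) ∣ Multiplicative.toAdd (α ⟨x, h⟩) := by
  constructor
  · rintro ⟨u, hu, rfl⟩
    exact ⟨u.2, hu⟩
  · rintro ⟨h, hd⟩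
    exact ⟨⟨x, h⟩, hd, rfl⟩

theorem Hgrp_le {U : Subgroup F2} (α : U →* Multiplicative ℤ) (n : ℕ) : Hgrp α n ≤ U :=
  fun x hx => ((mem_Hgrp α n x).1 hx).1

theorem Hgrp_anti {U : Subgroup F2} (α : U →* Multiplicative ℤ) {n m : ℕ} (h : n ∣ m) :
    Hgrp α m ≤ Hgrp α n := by
  intro x hx
  obtain ⟨hU, hd⟩ := (mem_Hgrp α m x).1 hx
  exact (mem_Hgrp α n x).2 ⟨hU, (Int.natCast_dvd_natCast.2 h).trans hd⟩

theorem conj_mem_Hgrp {U : Subgroup F2} (α : U →* Multiplicative ℤ) (n : ℕ) {u x : F2}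
    (hu : u ∈ U) (hx : x ∈ Hgrp α n) : u * x * u⁻¹ ∈ Hgrp α n := by
  obtain ⟨y, hy, rfl⟩ := hx
  refine ⟨⟨u, hu⟩ * y * ⟨u, hu⟩⁻¹, ?_, rfl⟩
  have : α (⟨u, hu⟩ * y * ⟨u, hu⟩⁻¹) = α y := by
    rw [map_mul, map_mul, map_inv, mul_comm (α ⟨u, hu⟩), mul_inv_cancel_right]
  rw [SetLike.mem_coe, Subgroup.mem_comap, this]
  exact hy

/-- Under Property B, `U` is the normalizer of `Hₙ`. -/
theorem normalizer_Hgrp {U : Subgroup F2} (α : U →* Multiplicative ℤ)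
    (hB : ∀ w : F2, w ∉ U → ¬ ∀ h ∈ Hgrp α 0, w * h * w⁻¹ ∈ U) (n : ℕ) :
    Subgroup.normalizer (Hgrp α n : Set F2) = U := by
  apply le_antisymm
  · intro w hw
    by_contra hwU
    exact hB w hwU fun h hh =>
      Hgrp_le α n ((Subgroup.mem_normalizer_iff.1 hw h).1 (Hgrp_anti α (dvd_zero n) hh))
  · intro u hu
    refine Subgroup.mem_normalizer_iff.2 fun x => ⟨conj_mem_Hgrp α n hu, fun hx => ?_⟩
    simpa [mul_assoc] using conj_mem_Hgrp α n (U.inv_mem hu) hx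

/-- If `α` is surjective and `n ∣ m`, then `Hₙ` is generated by `H_m` and the `n`-th powers
of elements of `U`. -/
theorem Hgrp_eq_sup_closure_pow {U : Subgroup F2} (α : U →* Multiplicative ℤ)
    (hα : Function.Surjective α) {n m : ℕ} (h : n ∣ m) :
    Hgrp α n = Hgrp α m ⊔ Subgroup.closure ((fun x => x ^ n) '' (U : Set F2)) := by
  apply le_antisymm
  · intro x hx
    obtain ⟨hU, c, hc⟩ := (mem_Hgrp α n x).1 hx
    obtain ⟨v, hv⟩ := hα (Multiplicative.ofAdd c)
    have hxv : x * ((v : F2) ^ n)⁻¹ ∈ Hgrp α m := by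
      refine Hgrp_anti α (dvd_zero m) ⟨⟨x, hU⟩ * (v ^ n)⁻¹, ?_, by simp⟩
      change ((0 : ℕ) : ℤ) ∣ Multiplicative.toAdd (α (⟨x, hU⟩ * (v ^ n)⁻¹))
      rw [map_mul, map_inv, map_pow, hv, toAdd_mul, hc]
      simp
    rw [← inv_mul_cancel_right x ((v : F2) ^ n)]
    exact Subgroup.mul_mem_sup hxv (Subgroup.subset_closure ⟨v, v.2, rfl⟩)
  · refine sup_le (Hgrp_anti α h) ((Subgroup.closure_le _).2 ?_)
    rintro _ ⟨u, hu, rfl⟩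
    refine ⟨⟨u, hu⟩ ^ n, ?_, rfl⟩
    change (n : ℤ) ∣ Multiplicative.toAdd (α (⟨u, hu⟩ ^ n))
    rw [map_pow, toAdd_pow, nsmul_eq_mul]
    exact dvd_mul_right _ _

theorem map_eq_of_map_Hgrp_eq {U : Subgroup F2} (α : U →* Multiplicative ℤ)
    (hB : ∀ w : F2, w ∉ U → ¬ ∀ h ∈ Hgrp α 0, w * h * w⁻¹ ∈ U) {n : ℕ} {γ : F2 ≃* F2}
    (hγ : Subgroup.map γ.toMonoidHom (Hgrp α n) = Hgrp α n) :
    Subgroup.map γ.toMonoidHom U = U := by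
  have := Subgroup.map_equiv_normalizer_eq (Hgrp α n) γ
  rwa [hγ, normalizer_Hgrp α hB] at this

theorem map_Hgrp_eq_of_dvd {U : Subgroup F2} (α : U →* Multiplicative ℤ)
    (hα : Function.Surjective α) {n m : ℕ} (h : n ∣ m) {γ : F2 ≃* F2}
    (hU : Subgroup.map γ.toMonoidHom U = U)
    (hγ : Subgroup.map γ.toMonoidHom (Hgrp α m) = Hgrp α m) :
    Subgroup.map γ.toMonoidHom (Hgrp α n) = Hgrp α n := by
  have hpow : γ.toMonoidHom '' ((fun x => x ^ n) '' (U : Set F2)) =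
      (fun x => x ^ n) '' (U : Set F2) := by
    conv_rhs => rw [← hU, Subgroup.coe_map]
    simp only [Set.image_image, map_pow]
  rw [Hgrp_eq_sup_closure_pow α hα h, Subgroup.map_sup, hγ, MonoidHom.map_closure, hpow]

/-- Setting A with Property B: for all `n ≥ 1`, `Γ(Hₙ) ⊆ Γ(U)`; for `n ∣ m`,
`Γ(H_m) ⊆ Γ(Hₙ)`; and if `Γ(U)` is not a congruence subgroup, then no `Γ(Hₙ)` is. -/
theorem veech_Hn_noncongruence_of_noncongruence
    (k : ℕ) (hk : 2 ≤ k) (U : Subgroup F2) (hfin : U.FiniteIndex)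
    (g : Fin k → F2)
    -- `g` is a free basis of `U`:
    (hgen : Subgroup.closure (Set.range g) = U)
    (hfree : Function.Injective ⇑(FreeGroup.lift g : FreeGroup (Fin k) →* F2))
    (hgU : ∀ j, g j ∈ U)
    -- `α : U → ℤ` is the homomorphism with `α(g₁) = 1` and `α(gⱼ) = 0` for `j ≥ 2`:
    (α : U →* Multiplicative ℤ)
    (hα0 : α ⟨g ⟨0, by omega⟩, hgU _⟩ = Multiplicative.ofAdd 1)
    (hαj : ∀ j : Fin k, j ≠ ⟨0, by omega⟩ → α ⟨g j, hgU j⟩ = 1)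
    -- Property B:
    (hB : ∀ w : F2, w ∉ U → ¬ ∀ h ∈ Hgrp α 0, w * h * w⁻¹ ∈ U)
    : (∀ n : ℕ, 1 ≤ n → VeechGroup (Hgrp α n) ⊆ VeechGroup U) ∧
      (∀ n m : ℕ, 1 ≤ n → 1 ≤ m → n ∣ m →
        VeechGroup (Hgrp α m) ⊆ VeechGroup (Hgrp α n)) ∧
      (¬ IsCongruenceSet (VeechGroup U) →
        ∀ n : ℕ, 1 ≤ n → ¬ IsCongruenceSet (VeechGroup (Hgrp α n))) := by
  have hα : Function.Surjective α := fun c =>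
    ⟨⟨g ⟨0, by omega⟩, hgU _⟩ ^ Multiplicative.toAdd c, by
      rw [map_zpow, hα0, ← ofAdd_zsmul]
      simp⟩
  have hsub : ∀ n : ℕ, 1 ≤ n → VeechGroup (Hgrp α n) ⊆ VeechGroup U := by
    rintro n - A ⟨γ, ⟨hdet, hγ⟩, hA⟩
    exact ⟨γ, ⟨hdet, map_eq_of_map_Hgrp_eq α hB hγ⟩, hA⟩
  refine ⟨hsub, ?_, ?_⟩
  · rintro n m - - hnm A ⟨γ, ⟨hdet, hγ⟩, hA⟩
    exact ⟨γ, ⟨hdet, map_Hgrp_eq_of_dvd α hα hnm (map_eq_of_map_Hgrp_eq α hB hγ) hγ⟩, hA⟩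
  · rintro hU n hn ⟨l, hl, hle⟩
    exact hU ⟨l, hl, hle.trans (hsub n hn)⟩
end

section
/- The subgroup U_L of F₂ satisfies Property B: for every w ∈ F₂ with w ∉ U_L, the conjugate w·H₀·w⁻¹ is not contained in U_L, where H₀ is the normal closure in U_L of {g₂, g₃, g₄, g₅} (equivalently, the kernel of the homomorphism α : U_L → ℤ with α(g₁) = 1 and α(gⱼ) = 0 for j = 2, …, 5). -/
/-- The monodromy permutations of the generators of `F₂` on the four left cosets of `UL`,
numbered as in `ULrep`. -/
def ULperm : Fin 2 → Equiv.Perm (Fin 4) :=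
  ![Equiv.swap 0 1 * Equiv.swap 0 2, Equiv.swap 0 3]

/-- The action of `F₂` on the four left cosets of `UL`. -/
def ULaction : F2 →* Equiv.Perm (Fin 4) := FreeGroup.lift ULperm

/-- Representatives of the left cosets of `UL`. -/
def ULrep : Fin 4 → F2 := ![1, xg⁻¹, (xg ^ 2)⁻¹, yg⁻¹]

lemma ULaction_xg : ULaction xg = Equiv.swap 0 1 * Equiv.swap 0 2 := by
  simp [ULaction, ULperm, xg]

lemma ULaction_yg : ULaction yg = Equiv.swap 0 3 := by
  simp [ULaction, ULperm, yg]

lemma mem_UL_xg_pow_three : xg ^ 3 ∈ UL := Subgroup.subset_closure (by simp)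

lemma mem_UL_conj_yg : xg * yg * xg⁻¹ ∈ UL := Subgroup.subset_closure (by simp)

lemma mem_UL_conj_sq_yg : xg ^ 2 * yg * (xg ^ 2)⁻¹ ∈ UL := Subgroup.subset_closure (by simp)

lemma mem_UL_conj_xg : yg * xg * yg⁻¹ ∈ UL := Subgroup.subset_closure (by simp)

lemma mem_UL_yg_sq : yg ^ 2 ∈ UL := Subgroup.subset_closure (by simp)

lemma ULaction_apply_zero {u : F2} (hu : u ∈ UL) : ULaction u 0 = 0 := by
  suffices UL ≤ (MulAction.stabilizer (Equiv.Perm (Fin 4)) (0 : Fin 4)).comap ULaction from this hu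
  refine (Subgroup.closure_le _).2 ?_
  rintro u (rfl | rfl | rfl | rfl | rfl) <;>
    simp only [SetLike.mem_coe, Subgroup.mem_comap, MulAction.mem_stabilizer_iff, map_mul, map_inv,
      map_pow, ULaction_xg, ULaction_yg] <;>
    decide

lemma ULrep_inv_mul_xg_mul (i : Fin 4) : (ULrep (ULaction xg i))⁻¹ * xg * ULrep i ∈ UL := by
  rw [ULaction_xg]
  fin_cases i
  · exact mem_UL_xg_pow_three
  · change 1⁻¹ * xg * xg⁻¹ ∈ UL
    simp
  · change xg⁻¹⁻¹ * xg * (xg ^ 2)⁻¹ ∈ UL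
    simp [pow_two]
  · exact mem_UL_conj_xg

lemma ULrep_inv_mul_yg_mul (i : Fin 4) : (ULrep (ULaction yg i))⁻¹ * yg * ULrep i ∈ UL := by
  rw [ULaction_yg]
  fin_cases i
  · exact mem_UL_yg_sq
  · exact mem_UL_conj_yg
  · exact mem_UL_conj_sq_yg
  · change 1⁻¹ * yg * yg⁻¹ ∈ UL
    simp

lemma ULrep_inv_mul_mul (w : F2) (i : Fin 4) : (ULrep (ULaction w i))⁻¹ * w * ULrep i ∈ UL := by
  induction w using FreeGroup.induction_on generalizing i with
  | C1 => simp
  | of j =>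
    fin_cases j
    · exact ULrep_inv_mul_xg_mul i
    · exact ULrep_inv_mul_yg_mul i
  | inv_of j ih =>
    have h := UL.inv_mem (ih ((ULaction (FreeGroup.of j))⁻¹ i))
    simpa [mul_assoc] using h
  | mul v w hv hw =>
    have h := UL.mul_mem (hv (ULaction w i)) (hw i)
    simpa [mul_assoc] using h

lemma mem_UL_iff {w : F2} : w ∈ UL ↔ ULaction w 0 = 0 :=
  ⟨ULaction_apply_zero, fun h => by simpa [h, ULrep] using ULrep_inv_mul_mul w 0⟩

lemma eq_zero_of_ULaction_conj_xg_apply_eq {j : Fin 4}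
    (hj : ULaction (yg * xg * yg⁻¹) j = j) : j = 0 := by
  simp only [map_mul, map_inv, ULaction_xg, ULaction_yg] at hj
  revert j
  decide

/-- The subgroup `U_L` of `F₂` (corresponding to the origami `L(2,3)`) satisfies
Property B: for every `w ∈ F₂` with `w ∉ U_L`, the conjugate `w·H₀·w⁻¹` is not contained
in `U_L`, where `H₀ = ker α`. -/
theorem UL_propertyB
    (α : UL →* Multiplicative ℤ)
    (hα1 : ∀ hm : xg ^ 3 ∈ UL, α ⟨xg ^ 3, hm⟩ = Multiplicative.ofAdd 1)
    (hα2 : ∀ hm : xg * yg * xg⁻¹ ∈ UL, α ⟨xg * yg * xg⁻¹, hm⟩ = 1)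
    (hα3 : ∀ hm : xg ^ 2 * yg * (xg ^ 2)⁻¹ ∈ UL, α ⟨xg ^ 2 * yg * (xg ^ 2)⁻¹, hm⟩ = 1)
    (hα4 : ∀ hm : yg * xg * yg⁻¹ ∈ UL, α ⟨yg * xg * yg⁻¹, hm⟩ = 1)
    (hα5 : ∀ hm : yg ^ 2 ∈ UL, α ⟨yg ^ 2, hm⟩ = 1)
    : ∀ w : F2, w ∉ UL → ¬ ∀ h ∈ Hgrp α 0, w * h * w⁻¹ ∈ UL := by
  intro w hw hconj
  have hmem : yg * xg * yg⁻¹ ∈ Hgrp α 0 := by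
    refine ⟨⟨_, mem_UL_conj_xg⟩, ?_, rfl⟩
    rw [SetLike.mem_coe, Subgroup.mem_comap, hα4 mem_UL_conj_xg]
    exact one_mem _
  have hfix := mem_UL_iff.1 (hconj _ hmem)
  rw [map_mul, map_mul, map_inv, Equiv.Perm.mul_apply, Equiv.Perm.mul_apply,
    ← Equiv.Perm.eq_inv_iff_eq] at hfix
  have hzero := eq_zero_of_ULaction_conj_xg_apply_eq hfix
  exact hw (mem_UL_iff.2 (Equiv.Perm.inv_eq_iff_eq.1 hzero).symm)
end

section
/- The subgroup U_D of F₂ satisfies Property B: for every w ∈ F₂ with w ∉ U_D, the conjugate w·H₀·w⁻¹ is not contained in U_D, where H₀ is the normal closure in U_D of {g₂, g₃, g₄, g₅, g₆} (equivalently, the kernel of the homomorphism α : U_D → ℤ with α(g₁) = 1 and α(gⱼ) = 0 for j = 2, …, 6). -/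
/-- The monodromy action of `F₂` on the five squares of `D`, as a left action: `w` acts by right
multiplication by `w⁻¹` on the right cosets of `U_D`. -/
def monodromyD : F2 →* Equiv.Perm (Fin 5) :=
  FreeGroup.lift ![c[0, 2, 1], c[0, 4, 3] * c[1, 2]]

/-- Representatives of the right cosets of `U_D`, indexed by the squares of `D`. -/
def transversalD : Fin 5 → F2 :=
  ![1, xg, xg ^ 2, yg, yg ^ 2]

lemma monodromyD_xg : monodromyD xg = c[0, 2, 1] := by
  simp [monodromyD, xg]

lemma monodromyD_yg : monodromyD yg = c[0, 4, 3] * c[1, 2] := by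
  simp [monodromyD, yg]

lemma transversalD_mul_xg_mem (i : Fin 5) :
    transversalD i * xg * (transversalD ((monodromyD xg)⁻¹ i))⁻¹ ∈ UD := by
  have h₃ : xg ^ 3 ∈ UD := Subgroup.subset_closure (by simp)
  have h₄ : yg * xg * yg⁻¹ ∈ UD := Subgroup.subset_closure (by simp)
  have h₅ : yg ^ 2 * xg * (yg ^ 2)⁻¹ ∈ UD := Subgroup.subset_closure (by simp)
  rw [monodromyD_xg]
  have e : ∀ i : Fin 5, (c[0, 2, 1] : Equiv.Perm (Fin 5))⁻¹ i = ![1, 2, 0, 3, 4] i := by decide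
  rw [e]
  fin_cases i
  · simp [transversalD, one_mem]
  · simp [transversalD, pow_two, one_mem]
  · simpa [transversalD, pow_succ] using h₃
  · exact h₄
  · exact h₅

lemma transversalD_mul_yg_mem (i : Fin 5) :
    transversalD i * yg * (transversalD ((monodromyD yg)⁻¹ i))⁻¹ ∈ UD := by
  have h₁ : xg * yg * (xg ^ 2)⁻¹ ∈ UD := Subgroup.subset_closure (by simp)
  have h₂ : xg ^ 2 * yg * xg⁻¹ ∈ UD := Subgroup.subset_closure (by simp)
  have h₃ : yg ^ 3 ∈ UD := Subgroup.subset_closure (by simp)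
  rw [monodromyD_yg]
  have e : ∀ i : Fin 5, (c[0, 4, 3] * c[1, 2] : Equiv.Perm (Fin 5))⁻¹ i = ![3, 2, 1, 4, 0] i := by
    decide
  rw [e]
  fin_cases i
  · simp [transversalD, one_mem]
  · exact h₁
  · exact h₂
  · simp [transversalD, pow_two, one_mem]
  · simpa [transversalD, pow_succ] using h₃

lemma transversalD_mul_mem (w : F2) (i : Fin 5) :
    transversalD i * w * (transversalD ((monodromyD w)⁻¹ i))⁻¹ ∈ UD := by
  have hof (k : Fin 2) (i : Fin 5) : transversalD i * FreeGroup.of k *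
      (transversalD ((monodromyD (FreeGroup.of k))⁻¹ i))⁻¹ ∈ UD := by
    fin_cases k
    · exact transversalD_mul_xg_mem i
    · exact transversalD_mul_yg_mem i
  induction w using FreeGroup.induction_on generalizing i with
  | C1 => simp [one_mem]
  | of k => exact hof k i
  | inv_of k _ =>
    simpa [mul_assoc] using inv_mem (hof k (monodromyD (FreeGroup.of k) i))
  | mul u v hu hv =>
    simpa [mul_assoc] using mul_mem (hu i) (hv ((monodromyD u)⁻¹ i))

lemma monodromyD_apply_zero_of_mem {w : F2} (hw : w ∈ UD) : monodromyD w 0 = 0 := by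
  have hle : UD ≤ (MulAction.stabilizer (Equiv.Perm (Fin 5)) (0 : Fin 5)).comap monodromyD := by
    refine (Subgroup.closure_le _).2 ?_
    rintro _ (rfl | rfl | rfl | rfl | rfl | rfl) <;>
      simp only [Subgroup.coe_comap, Set.mem_preimage, SetLike.mem_coe, MulAction.mem_stabilizer_iff,
        Equiv.Perm.smul_def, map_mul, map_pow, map_inv, monodromyD_xg, monodromyD_yg] <;>
      decide
  exact hle hw

lemma mem_UD_iff {w : F2} : w ∈ UD ↔ monodromyD w 0 = 0 := by
  refine ⟨monodromyD_apply_zero_of_mem, fun h => ?_⟩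
  have h' : (monodromyD w)⁻¹ 0 = 0 := by rw [Equiv.Perm.inv_eq_iff_eq, h]
  simpa [h', transversalD] using transversalD_mul_mem w 0

lemma conj_mem_UD_iff {w h : F2} :
    w * h * w⁻¹ ∈ UD ↔ monodromyD h ((monodromyD w)⁻¹ 0) = (monodromyD w)⁻¹ 0 := by
  rw [mem_UD_iff, map_mul, map_mul, map_inv, Equiv.Perm.mul_apply, Equiv.Perm.mul_apply,
    Equiv.Perm.eq_inv_iff_eq]

lemma mem_Hgrp_zero {U : Subgroup F2} {α : U →* Multiplicative ℤ} {h : F2} (hU : h ∈ U)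
    (hα : α ⟨h, hU⟩ = 1) : h ∈ Hgrp α 0 :=
  ⟨⟨h, hU⟩, by rw [SetLike.mem_coe, Subgroup.mem_comap, hα]; exact one_mem _, rfl⟩

lemma eq_zero_of_monodromyD_fixed {i : Fin 5} (h₄ : monodromyD (yg * xg * yg⁻¹) i = i)
    (h₅ : monodromyD (yg ^ 2 * xg * (yg ^ 2)⁻¹) i = i) : i = 0 := by
  simp only [map_mul, map_pow, map_inv, monodromyD_xg, monodromyD_yg] at h₄ h₅
  revert i
  decide

/-- The subgroup `U_D` of `F₂` (corresponding to the origami `D`) satisfies Property B: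
for every `w ∈ F₂` with `w ∉ U_D`, the conjugate `w·H₀·w⁻¹` is not contained in `U_D`,
where `H₀ = ker α`. -/
theorem UD_propertyB
    (α : UD →* Multiplicative ℤ)
    (hα1 : ∀ hm : xg ^ 3 ∈ UD, α ⟨xg ^ 3, hm⟩ = Multiplicative.ofAdd 1)
    (hα2 : ∀ hm : xg * yg * (xg ^ 2)⁻¹ ∈ UD, α ⟨xg * yg * (xg ^ 2)⁻¹, hm⟩ = 1)
    (hα3 : ∀ hm : xg ^ 2 * yg * xg⁻¹ ∈ UD, α ⟨xg ^ 2 * yg * xg⁻¹, hm⟩ = 1)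
    (hα4 : ∀ hm : yg * xg * yg⁻¹ ∈ UD, α ⟨yg * xg * yg⁻¹, hm⟩ = 1)
    (hα5 : ∀ hm : yg ^ 2 * xg * (yg ^ 2)⁻¹ ∈ UD, α ⟨yg ^ 2 * xg * (yg ^ 2)⁻¹, hm⟩ = 1)
    (hα6 : ∀ hm : yg ^ 3 ∈ UD, α ⟨yg ^ 3, hm⟩ = 1)
    : ∀ w : F2, w ∉ UD → ¬ ∀ h ∈ Hgrp α 0, w * h * w⁻¹ ∈ UD := by
  intro w hw hconj
  have g₄ : yg * xg * yg⁻¹ ∈ UD := Subgroup.subset_closure (by simp)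
  have g₅ : yg ^ 2 * xg * (yg ^ 2)⁻¹ ∈ UD := Subgroup.subset_closure (by simp)
  have hfix := eq_zero_of_monodromyD_fixed
    (conj_mem_UD_iff.1 (hconj _ (mem_Hgrp_zero g₄ (hα4 g₄))))
    (conj_mem_UD_iff.1 (hconj _ (mem_Hgrp_zero g₅ (hα5 g₅))))
  rw [Equiv.Perm.inv_eq_iff_eq] at hfix
  exact hw (mem_UD_iff.2 hfix.symm)
end

section
/- For the sequence of subgroups Hₙ built from U_L as in Setting A, for every n ≥ 1 and every integer s: the matrix [[1, s],[0, 1]] belongs to the Veech group Γ(Hₙ) if and only if 3n divides s. -/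
namespace FreeGroup

section CommonPrefix

variable {α : Type*} [DecidableEq α]

/-- The length of the longest common prefix of two lists. -/
def commonPrefixLength {β : Type*} [DecidableEq β] : List β → List β → ℕ
  | a :: l, b :: m => if a = b then commonPrefixLength l m + 1 else 0
  | [], _ => 0
  | _ :: _, [] => 0

theorem commonPrefixLength_comm {β : Type*} [DecidableEq β] (l m : List β) :
    commonPrefixLength l m = commonPrefixLength m l := by
  induction l generalizing m with
  | nil => cases m <;> simp [commonPrefixLength]
  | cons a l ih =>
    cases m with
    | nil => simp [commonPrefixLength]
    | cons b m => simp [commonPrefixLength, ih m, eq_comm]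

theorem min_commonPrefixLength_le {β : Type*} [DecidableEq β] (l m k : List β) :
    min (commonPrefixLength l m) (commonPrefixLength m k) ≤ commonPrefixLength l k := by
  induction l generalizing m k with
  | nil => cases m <;> simp [commonPrefixLength]
  | cons a l ih =>
    cases m with
    | nil => simp [commonPrefixLength]
    | cons b m =>
      cases k with
      | nil => simp [commonPrefixLength]
      | cons c k =>
        have := ih m k
        by_cases h1 : a = b <;> by_cases h2 : b = c <;> simp_all [commonPrefixLength]

theorem length_reduce_invRev_append (L M : List (α × Bool)) (hL : IsReduced L)
    (hM : IsReduced M) :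
    (reduce (invRev L ++ M)).length + 2 * commonPrefixLength L M = L.length + M.length := by
  induction L generalizing M with
  | nil => cases M <;> simp [commonPrefixLength, hM.reduce_eq]
  | cons p L ih =>
    cases M with
    | nil => simp [commonPrefixLength, hL.reduce_eq, reduce_invRev]
    | cons q M =>
      by_cases h : p = q
      · subst h
        have hL' : IsReduced L := hL.infix ⟨[p], [], by simp⟩
        have hM' : IsReduced M := hM.infix ⟨[p], [], by simp⟩
        have hred : reduce (invRev (p :: L) ++ p :: M) = reduce (invRev L ++ M) := by
          apply reduce.eq_of_red
          apply Red.Step.to_red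
          have := Red.Step.not (L₁ := invRev L) (L₂ := M) (x := p.1) (b := !p.2)
          simpa [invRev] using this
        have := ih M hL' hM'
        simp only [hred, commonPrefixLength, if_true, List.length_cons]
        omega
      · have hr : IsReduced (invRev (p :: L) ++ q :: M) := by
          have h1 : IsReduced (invRev (p :: L)) := by
            rw [isReduced_iff_reduce_eq, reduce_invRev, hL.reduce_eq]
          rw [IsReduced, List.isChain_append]
          refine ⟨h1, hM, ?_⟩
          intro x hx y hy
          simp [invRev] at hx hy
          subst hx hy
          intro h3
          by_contra h4
          apply h
          ext <;> simp_all
        rw [hr.reduce_eq]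
        simp [commonPrefixLength, h]

/-- The Gromov product at `1` of two elements of a free group: the length of the longest common
prefix of their reduced words. -/
def gromovProd (a b : FreeGroup α) : ℕ := commonPrefixLength a.toWord b.toWord

theorem gromovProd_comm (a b : FreeGroup α) : gromovProd a b = gromovProd b a :=
  commonPrefixLength_comm _ _

theorem min_gromovProd_le (a b c : FreeGroup α) :
    min (gromovProd a b) (gromovProd b c) ≤ gromovProd a c :=
  min_commonPrefixLength_le _ _ _

theorem norm_inv_mul (a b : FreeGroup α) :
    norm (a⁻¹ * b) + 2 * gromovProd a b = norm a + norm b := by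
  rw [norm, toWord_mul, toWord_inv]
  exact length_reduce_invRev_append _ _ isReduced_toWord isReduced_toWord

theorem norm_mul (a b : FreeGroup α) :
    norm (a * b) + 2 * gromovProd a⁻¹ b = norm a + norm b := by
  simpa using norm_inv_mul a⁻¹ b

theorem gromovProd_self_mul (a b : FreeGroup α) :
    gromovProd a (a * b) + gromovProd a⁻¹ b = norm a := by
  have h1 := norm_inv_mul a (a * b)
  have h2 := norm_mul a b
  rw [inv_mul_cancel_left] at h1
  omega

theorem two_mul_gromovProd_inv_lt {a : FreeGroup α} (ha : a ≠ 1) :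
    2 * gromovProd a a⁻¹ < norm a := by
  have h1 := norm_mul a a
  have h2 := reduceCyclically.reduce_flatten_replicate_succ (isReduced_toWord (x := a)) 1
  have h3 := congrArg List.length
    (reduceCyclically.conj_conjugator_reduceCyclically a.toWord)
  have h4 := congrArg List.length h2
  have h5 : norm (a * a) = (reduce (List.replicate (1 + 1) a.toWord).flatten).length := by
    rw [norm, toWord_mul]; simp [List.replicate]
  have h6 : reduceCyclically a.toWord ≠ [] := by
    intro h
    have h7 := reduceCyclically.conj_conjugator_reduceCyclically a.toWord
    rw [h] at h7
    apply ha
    rw [← mk_toWord (x := a), ← h7, List.append_nil, ← mul_mk, ← inv_mk, mul_inv_cancel]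
  have h8 := List.length_pos_iff.mpr h6
  rw [h4] at h5
  simp [List.replicate] at h5 h3
  rw [gromovProd_comm]
  have : norm a = a.toWord.length := rfl
  omega

/-- If the words of `a` and `b` share their first letter, one can cancel that letter. -/
theorem exists_norm_mul_lt {a b : FreeGroup α} (h : gromovProd a b ≠ 0) :
    ∃ g : FreeGroup α, norm g = 1 ∧ norm (g * a) + 1 = norm a ∧ norm (g * b) + 1 = norm b := by
  rcases hA : a.toWord with _ | ⟨p, L⟩
  · simp [gromovProd, hA, commonPrefixLength] at h
  rcases hB : b.toWord with _ | ⟨q, M⟩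
  · simp [gromovProd, hB, hA, commonPrefixLength] at h
  by_cases hpq : p = q
  · subst hpq
    have hn : ∀ (c : FreeGroup α) (K), c.toWord = p :: K →
        norm ((mk [p])⁻¹ * c) + 1 = norm c := by
      intro c K hc
      have hK : IsReduced K := by
        have := isReduced_toWord (x := c)
        rw [hc] at this
        exact this.infix ⟨[p], [], by simp⟩
      have : (mk [p])⁻¹ * c = mk K := by
        rw [inv_mul_eq_iff_eq_mul, mul_mk, ← mk_toWord (x := c), hc]; rfl
      rw [this, norm, norm, toWord_mk, hK.reduce_eq, hc]; rfl
    exact ⟨(mk [p])⁻¹, by rw [norm_inv_eq, norm, toWord_mk, reduce_singleton]; rfl, hn a L hA,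
      hn b M hB⟩
  · simp [gromovProd, hA, hB, commonPrefixLength, hpq] at h

end CommonPrefix

section NielsenReduced

variable {α β : Type*} [DecidableEq α] [DecidableEq β]

/-- Nielsen's condition on the images of the letters under a homomorphism of free groups: in any
reduced product of these images, some part of every factor survives the cancellation. -/
def IsNielsenReduced (φ : FreeGroup α →* FreeGroup β) : Prop :=
  ∀ l e k : α × Bool, e ≠ l → k ≠ (l.1, !l.2) →
    gromovProd (φ (mk [e])) (φ (mk [l])) + gromovProd (φ (mk [l]))⁻¹ (φ (mk [k])) <
      norm (φ (mk [l]))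

omit [DecidableEq α] in
theorem mk_singleton_not (l : α × Bool) : (mk [(l.1, !l.2)] : FreeGroup α) = (mk [l])⁻¹ := by
  simp [inv_mk, invRev]

omit [DecidableEq α] in
theorem IsNielsenReduced.gromovProd_map_mk_cons {φ : FreeGroup α →* FreeGroup β}
    (hφ : IsNielsenReduced φ) (l : α × Bool) (L : List (α × Bool)) (hL : IsReduced (l :: L)) :
    (∀ e ≠ l, gromovProd (φ (mk [e])) (φ (mk (l :: L))) =
        gromovProd (φ (mk [e])) (φ (mk [l])) ∧
      gromovProd (φ (mk [e])) (φ (mk [l])) < norm (φ (mk (l :: L)))) ∧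
    (L ≠ [] → 2 ≤ norm (φ (mk (l :: L)))) := by
  induction L generalizing l with
  | nil =>
    refine ⟨fun e he => ⟨rfl, ?_⟩, by simp⟩
    have hne : l ≠ (l.1, !l.2) := fun h => by simpa using congrArg Prod.snd h
    have := hφ l e l he hne
    omega
  | cons k L ih =>
    rw [isReduced_cons_cons] at hL
    have hk : (l.1, !l.2) ≠ k := by
      rintro rfl
      simpa using hL.1
    obtain ⟨h1, h2⟩ := (ih k hL.2).1 _ hk
    rw [mk_singleton_not, _root_.map_inv] at h1 h2
    have hP : φ (mk (l :: k :: L)) = φ (mk [l]) * φ (mk (k :: L)) := by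
      rw [← _root_.map_mul, mul_mk]; rfl
    have h3 := norm_mul (φ (mk [l])) (φ (mk (k :: L)))
    have h4 := gromovProd_self_mul (φ (mk [l])) (φ (mk (k :: L)))
    rw [hP]
    have key : ∀ e ≠ l, gromovProd (φ (mk [e])) (φ (mk [l])) <
        gromovProd (φ (mk [l])) (φ (mk [l]) * φ (mk (k :: L))) := by
      intro e he
      have := hφ l e k he hk.symm
      omega
    have hne : (l.1, !l.2) ≠ l := fun h => by simpa using congrArg Prod.snd h
    refine ⟨fun e he => ?_, fun _ => ?_⟩
    · have h5 := key e he
      have h6 := min_gromovProd_le (φ (mk [e])) (φ (mk [l])) (φ (mk [l]) * φ (mk (k :: L)))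
      have h7 := min_gromovProd_le (φ (mk [e])) (φ (mk [l]) * φ (mk (k :: L))) (φ (mk [l]))
      rw [gromovProd_comm _ (φ (mk [l]))] at h7
      constructor <;> omega
    · have h5 := key _ hne
      omega

/-- A Nielsen reduced homomorphism sends only letters to letters. -/
theorem IsNielsenReduced.exists_eq_mk_singleton {φ : FreeGroup α →* FreeGroup β}
    (hφ : IsNielsenReduced φ) {w : FreeGroup α} (hw : norm (φ w) = 1) :
    ∃ l, w = mk [l] := by
  rcases h : w.toWord with _ | ⟨l, _ | ⟨k, L⟩⟩
  · rw [toWord_eq_nil_iff] at h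
    simp [h] at hw
  · exact ⟨l, by rw [← h, mk_toWord]⟩
  · have hr := isReduced_toWord (x := w)
    rw [h] at hr
    have := (hφ.gromovProd_map_mk_cons l (k :: L) hr).2 (by simp)
    rw [← h, mk_toWord] at this
    omega

end NielsenReduced

end FreeGroup

section NielsenTheorem

open FreeGroup

theorem F2.aut_ext {γ δ : MulAut F2} (hx : γ xg = δ xg) (hy : γ yg = δ yg) : γ = δ := by
  have : γ.toMonoidHom = δ.toMonoidHom := by
    refine FreeGroup.ext_hom _ _ fun i => ?_
    fin_cases i
    · exact hx
    · exact hy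
  exact MulEquiv.ext fun w => DFunLike.congr_fun this w

/-- The automorphism of `F₂` with prescribed images of `x` and `y`, given the images under its
inverse. -/
def autOfImages (u v u' v' : F2)
    (h1 : FreeGroup.lift ![u', v'] u = xg) (h2 : FreeGroup.lift ![u', v'] v = yg)
    (h3 : FreeGroup.lift ![u, v] u' = xg) (h4 : FreeGroup.lift ![u, v] v' = yg) : MulAut F2 :=
  MonoidHom.toMulEquiv (FreeGroup.lift ![u, v]) (FreeGroup.lift ![u', v'])
    (FreeGroup.ext_hom _ _ fun i => by fin_cases i <;> simpa)
    (FreeGroup.ext_hom _ _ fun i => by fin_cases i <;> simpa)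

/-- The automorphism of `F₂` exchanging `x` and `y`. -/
def swapAut : MulAut F2 :=
  autOfImages yg xg yg xg (by simp [yg]) (by simp [xg]) (by simp [yg]) (by simp [xg])

/-- The automorphism `x ↦ x⁻¹`, `y ↦ y` of `F₂`. -/
def invAut : MulAut F2 :=
  autOfImages xg⁻¹ yg xg⁻¹ yg (by simp [xg]) (by simp [yg]) (by simp [xg]) (by simp [yg])

/-- The automorphism `x ↦ x`, `y ↦ xy` of `F₂`. -/
def shearAut : MulAut F2 :=
  autOfImages xg (xg * yg) xg (xg⁻¹ * yg) (by simp [xg]) (by simp [xg, yg]) (by simp [xg])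
    (by simp [xg, yg])

theorem autOfImages_xg {u v u' v' : F2} (h1 h2 h3 h4) :
    autOfImages u v u' v' h1 h2 h3 h4 xg = u := by
  change FreeGroup.lift ![u, v] xg = u
  simp [xg]

theorem autOfImages_yg {u v u' v' : F2} (h1 h2 h3 h4) :
    autOfImages u v u' v' h1 h2 h3 h4 yg = v := by
  change FreeGroup.lift ![u, v] yg = v
  simp [yg]

@[simp] theorem swapAut_xg : swapAut xg = yg := autOfImages_xg ..
@[simp] theorem swapAut_yg : swapAut yg = xg := autOfImages_yg ..
@[simp] theorem invAut_xg : invAut xg = xg⁻¹ := autOfImages_xg ..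
@[simp] theorem invAut_yg : invAut yg = yg := autOfImages_yg ..
@[simp] theorem shearAut_xg : shearAut xg = xg := autOfImages_xg ..
@[simp] theorem shearAut_yg : shearAut yg = xg * yg := autOfImages_yg ..

theorem isNielsenReduced_of_gromovProd (φ : F2 →* F2)
    (h1 : gromovProd (φ xg)⁻¹ (φ yg) = 0) (h2 : gromovProd (φ xg) (φ yg)⁻¹ = 0)
    (h3 : gromovProd (φ xg)⁻¹ (φ yg)⁻¹ = 0)
    (hx : 2 * gromovProd (φ xg) (φ xg)⁻¹ + gromovProd (φ xg) (φ yg) < norm (φ xg))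
    (hy : 2 * gromovProd (φ yg) (φ yg)⁻¹ + gromovProd (φ xg) (φ yg) < norm (φ yg)) :
    IsNielsenReduced φ := by
  have e1 : (mk [(0, true)] : F2) = xg := rfl
  have e2 : (mk [(1, true)] : F2) = yg := rfl
  have e3 : (mk [(0, false)] : F2) = xg⁻¹ := rfl
  have e4 : (mk [(1, false)] : F2) = yg⁻¹ := rfl
  have c1 := gromovProd_comm (φ xg)⁻¹ (φ yg)
  have c2 := gromovProd_comm (φ xg) (φ yg)⁻¹
  have c3 := gromovProd_comm (φ xg)⁻¹ (φ yg)⁻¹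
  have c4 := gromovProd_comm (φ xg) (φ yg)
  have c5 := gromovProd_comm (φ xg) (φ xg)⁻¹
  have c6 := gromovProd_comm (φ yg) (φ yg)⁻¹
  rintro ⟨l, bl⟩ ⟨e, be⟩ ⟨k, bk⟩ he hk
  fin_cases l <;> fin_cases e <;> fin_cases k <;> cases bl <;> cases be <;> cases bk <;>
    first
    | exact absurd rfl he
    | exact absurd rfl hk
    | simp only [Fin.zero_eta, Fin.mk_one, Fin.isValue, e1, e2, e3, e4, _root_.map_inv, inv_inv,
        norm_inv_eq]
      omega

/-- An automorphism of `F₂` permuting the letters lies in any subgroup containing the generators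
of the group of signed permutations. -/
theorem mem_of_map_eq_mk_singleton {K : Subgroup (MulAut F2)} (hs : swapAut ∈ K)
    (ht : invAut ∈ K) {δ : MulAut F2} {l m : Fin 2 × Bool} (hx : δ xg = mk [l])
    (hy : δ yg = mk [m]) : δ ∈ K := by
  have e1 : (mk [(0, true)] : F2) = xg := rfl
  have e2 : (mk [(1, true)] : F2) = yg := rfl
  have e3 : (mk [(0, false)] : F2) = xg⁻¹ := rfl
  have e4 : (mk [(1, false)] : F2) = yg⁻¹ := rfl
  have hne : xg ≠ yg ∧ xg ≠ yg⁻¹ := by constructor <;> decide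
  have n1 : δ xg ≠ δ yg := δ.injective.ne hne.1
  have n2 : δ xg ≠ (δ yg)⁻¹ := by
    rw [← _root_.map_inv]
    exact δ.injective.ne hne.2
  obtain ⟨l, bl⟩ := l
  obtain ⟨m, bm⟩ := m
  have key : ∀ ε ∈ K, δ xg = ε xg → δ yg = ε yg → δ ∈ K := fun ε hε h1 h2 => by
    rwa [F2.aut_ext h1 h2]
  fin_cases l <;> fin_cases m <;> cases bl <;> cases bm <;>
    simp only [Fin.zero_eta, Fin.mk_one, Fin.isValue, e1, e2, e3, e4] at hx hy <;>
    solve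
    | (exfalso; simp_all)
    | (refine key 1 (one_mem K) ?_ ?_ <;> simp [hx, hy])
    | (refine key _ ht ?_ ?_ <;> simp [hx, hy])
    | (refine key _ hs ?_ ?_ <;> simp [hx, hy])
    | (refine key _ (K.mul_mem hs ht) ?_ ?_ <;> simp [hx, hy])
    | (refine key _ (K.mul_mem ht hs) ?_ ?_ <;> simp [hx, hy])
    | (refine key _ (K.mul_mem ht (K.mul_mem hs ht)) ?_ ?_ <;> simp [hx, hy])
    | (refine key _ (K.mul_mem hs (K.mul_mem ht hs)) ?_ ?_ <;> simp [hx, hy])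
    | (refine key _ (K.mul_mem ht (K.mul_mem hs (K.mul_mem ht hs))) ?_ ?_ <;> simp [hx, hy])

theorem mem_of_isNielsenReduced {K : Subgroup (MulAut F2)} (hs : swapAut ∈ K)
    (ht : invAut ∈ K) {γ : MulAut F2} (hγ : IsNielsenReduced γ.toMonoidHom) : γ ∈ K := by
  obtain ⟨l, hl⟩ := hγ.exists_eq_mk_singleton (w := γ⁻¹ xg) (by
    change norm (γ (γ⁻¹ xg)) = 1
    rw [MulAut.apply_inv_self]; exact norm_of _)
  obtain ⟨m, hm⟩ := hγ.exists_eq_mk_singleton (w := γ⁻¹ yg) (by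
    change norm (γ (γ⁻¹ yg)) = 1
    rw [MulAut.apply_inv_self]; exact norm_of _)
  exact inv_mem_iff.mp (mem_of_map_eq_mk_singleton hs ht hl hm)

/-- An automorphism outside `K` whose values at `x` and `y` are read off from three elements
of `F₂`, thought of as the labels of the edges of a theta graph. -/
def IsThetaOutside (K : Subgroup (MulAut F2)) (a b c : F2) : Prop :=
  ∃ γ : MulAut F2, γ ∉ K ∧ γ xg = a⁻¹ * b ∧ γ yg = a⁻¹ * c

namespace IsThetaOutside

variable {K : Subgroup (MulAut F2)} {a b c : F2}

theorem mul_left (h : IsThetaOutside K a b c) (g : F2) :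
    IsThetaOutside K (g * a) (g * b) (g * c) := by
  obtain ⟨γ, h, hx, hy⟩ := h
  exact ⟨γ, h, by rw [hx]; group, by rw [hy]; group⟩

theorem swap_right (hs : swapAut ∈ K) (h : IsThetaOutside K a b c) :
    IsThetaOutside K a c b := by
  obtain ⟨γ, h, hx, hy⟩ := h
  exact ⟨γ * swapAut, by rwa [K.mul_mem_cancel_right hs], by simpa, by simpa⟩

theorem swap_left (ht : invAut ∈ K) (hU : shearAut ∈ K) (h : IsThetaOutside K a b c) :
    IsThetaOutside K b a c := by
  obtain ⟨γ, h, hx, hy⟩ := h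
  exact ⟨γ * (invAut * shearAut), by rwa [K.mul_mem_cancel_right (K.mul_mem ht hU)],
    by simp [hx], by simp [hx, hy]⟩

theorem inv (hs : swapAut ∈ K) (ht : invAut ∈ K) (hc : ∀ g, MulAut.conj g ∈ K)
    (h : IsThetaOutside K a b c) : IsThetaOutside K a⁻¹ b⁻¹ c⁻¹ := by
  obtain ⟨γ, h, hx, hy⟩ := h
  have hk : invAut * (swapAut * (invAut * swapAut)) ∈ K :=
    K.mul_mem ht (K.mul_mem hs (K.mul_mem ht hs))
  exact ⟨MulAut.conj a * (γ * (invAut * (swapAut * (invAut * swapAut)))),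
    by rwa [K.mul_mem_cancel_left (hc a), K.mul_mem_cancel_right hk],
    by simp [hx, mul_assoc], by simp [hy, mul_assoc]⟩

theorem inv_of_one (ht : invAut ∈ K) (h : IsThetaOutside K 1 b c) :
    IsThetaOutside K 1 b⁻¹ c := by
  obtain ⟨γ, h, hx, hy⟩ := h
  exact ⟨γ * invAut, by rwa [K.mul_mem_cancel_right ht], by simp [hx], by simp [hy]⟩

theorem ne (h : IsThetaOutside K a b c) : a ≠ b := by
  rintro rfl
  obtain ⟨γ, -, hx, -⟩ := h
  rw [inv_mul_cancel, map_eq_one_iff γ γ.injective] at hx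
  exact absurd hx (by decide)

/-- Cancelling a common first letter shortens the labels. -/
theorem gromovProd_eq_zero (h : IsThetaOutside K a b c)
    (hmin : ∀ a' b' c', IsThetaOutside K a' b' c' →
      norm a + norm b + norm c ≤ norm a' + norm b' + norm c') : gromovProd a b = 0 := by
  by_contra hne
  obtain ⟨g, hg, ha, hb⟩ := exists_norm_mul_lt hne
  have h1 := hmin _ _ _ (h.mul_left g)
  have h2 := norm_mul_le g c
  omega

end IsThetaOutside

/-- Nielsen's theorem: the automorphism group of `F₂` is generated by the elementary Nielsen
transformations and the inner automorphisms. -/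
theorem mem_of_elementary_mem {K : Subgroup (MulAut F2)} (hs : swapAut ∈ K) (ht : invAut ∈ K)
    (hU : shearAut ∈ K) (hc : ∀ g, MulAut.conj g ∈ K) (γ : MulAut F2) : γ ∈ K := by
  by_contra hγ
  have hex : ∃ n a b c, IsThetaOutside K a b c ∧ norm a + norm b + norm c = n :=
    ⟨_, 1, γ xg, γ yg, ⟨γ, hγ, by simp, by simp⟩, rfl⟩
  classical
  obtain ⟨a, b, c, h, hn⟩ := Nat.find_spec hex
  have hmin : ∀ a' b' c', IsThetaOutside K a' b' c' →
      Nat.find hex ≤ norm a' + norm b' + norm c' :=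
    fun a' b' c' h' => Nat.find_min' hex ⟨a', b', c', h', rfl⟩
  generalize Nat.find hex = n at hn hmin
  -- vanishing of all the relevant Gromov products
  have hzero : ∀ a b c, IsThetaOutside K a b c → norm a + norm b + norm c = n →
      gromovProd a b = 0 ∧ gromovProd a c = 0 ∧ gromovProd b c = 0 := by
    intro a b c h hn
    refine ⟨h.gromovProd_eq_zero (by simpa only [hn] using hmin),
      (h.swap_right hs).gromovProd_eq_zero ?_,
      ((h.swap_left ht hU).swap_right hs).gromovProd_eq_zero ?_⟩
    · rwa [show norm a + norm c + norm b = n by omega]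
    · rwa [show norm b + norm c + norm a = n by omega]
  have hne : ∀ a b c, IsThetaOutside K a b c → norm a + norm b + norm c = n → a ≠ 1 := by
    rintro _ b c h hn rfl
    have hb : b ≠ 1 := (h.ne).symm
    have hc1 : c ≠ 1 := ((h.swap_right hs).ne).symm
    have z1 := (hzero _ _ _ h hn).2.2
    have z2 := (hzero _ _ _ (h.inv_of_one ht) (by simpa using hn)).2.2
    have h3 := h.inv hs ht hc
    rw [inv_one] at h3
    have z3 := (hzero _ _ _ h3 (by simpa using hn)).2.2
    have z4 := (hzero _ _ _ (h3.inv_of_one ht) (by simpa using hn)).2.2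
    rw [inv_inv] at z4
    obtain ⟨δ, hδ, hx, hy⟩ := h
    rw [inv_one, one_mul] at hx hy
    refine hδ (mem_of_isNielsenReduced hs ht (isNielsenReduced_of_gromovProd _ ?_ ?_ ?_ ?_ ?_)) <;>
      simp only [MulEquiv.toMonoidHom_eq_coe, MonoidHom.coe_coe, hx, hy, z1, z2, z3, z4, add_zero]
    · exact two_mul_gromovProd_inv_lt hb
    · exact two_mul_gromovProd_inv_lt hc1
  have ha : a ≠ 1 := hne a b c h hn
  have hb : b ≠ 1 := hne b a c (h.swap_left ht hU) (by omega)
  have hc1 : c ≠ 1 := hne c a b ((h.swap_right hs).swap_left ht hU) (by omega)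
  obtain ⟨z1, z2, z3⟩ := hzero a b c h hn
  obtain ⟨y1, y2, y3⟩ := hzero _ _ _ (h.inv hs ht hc) (by simpa using hn)
  obtain ⟨δ, hδ, hx, hy⟩ := h
  have ha' : 0 < norm a := Nat.pos_of_ne_zero (by rwa [Ne, FreeGroup.norm_eq_zero])
  have hb' : 0 < norm b := Nat.pos_of_ne_zero (by rwa [Ne, FreeGroup.norm_eq_zero])
  have hc' : 0 < norm c := Nat.pos_of_ne_zero (by rwa [Ne, FreeGroup.norm_eq_zero])
  -- the reduced word of `p⁻¹ * q` starts with that of `p⁻¹`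
  have pre : ∀ p q : F2, gromovProd p q = 0 → gromovProd p⁻¹ (p⁻¹ * q) = norm p := by
    intro p q hpq
    have := gromovProd_self_mul p⁻¹ q
    rw [inv_inv, hpq, norm_inv_eq] at this
    omega
  -- hence words starting with `p⁻¹` and `r⁻¹` have no common prefix
  have key : ∀ p q r t : F2, gromovProd p q = 0 → gromovProd r t = 0 → 0 < norm p → 0 < norm r →
      gromovProd p⁻¹ r⁻¹ = 0 → gromovProd (p⁻¹ * q) (r⁻¹ * t) = 0 := by
    intro p q r t h1 h2 h3 h4 h5
    have e1 := pre p q h1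
    have e2 := pre r t h2
    have e3 := min_gromovProd_le p⁻¹ (p⁻¹ * q) r⁻¹
    have e4 := min_gromovProd_le (p⁻¹ * q) (r⁻¹ * t) r⁻¹
    rw [gromovProd_comm (r⁻¹ * t)] at e4
    omega
  have nu := norm_inv_mul a b
  have nv := norm_inv_mul a c
  have nw := norm_inv_mul b c
  have nuv := norm_inv_mul (a⁻¹ * b) (a⁻¹ * c)
  rw [show (a⁻¹ * b)⁻¹ * (a⁻¹ * c) = b⁻¹ * c by group] at nuv
  have k1 := key a b b a z1 (by rwa [gromovProd_comm]) ha' hb' y1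
  have k2 := key a c c a z2 (by rwa [gromovProd_comm]) ha' hc' y2
  have k3 := key b a a c (by rwa [gromovProd_comm]) z2 hb' ha' (by rwa [gromovProd_comm])
  have k4 := key a b c a z1 (by rwa [gromovProd_comm]) ha' hc' y2
  have k5 := key b a c a (by rwa [gromovProd_comm]) (by rwa [gromovProd_comm]) hb' hc' y3
  have iu : (a⁻¹ * b)⁻¹ = b⁻¹ * a := by group
  have iv : (a⁻¹ * c)⁻¹ = c⁻¹ * a := by group
  refine hδ (mem_of_isNielsenReduced hs ht (isNielsenReduced_of_gromovProd _ ?_ ?_ ?_ ?_ ?_)) <;>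
    simp only [MulEquiv.toMonoidHom_eq_coe, MonoidHom.coe_coe, hx, hy, iu, iv, k1, k2, k3, k4,
      k5] <;> omega

end NielsenTheorem

section GeneratedByElementary

variable {G : Type*} [Group G] {s t u : G}

theorem mem_closure_pair_cases (hs : s * s = 1) (ht : t * t = 1)
    (hst : t * (s * (t * s)) = s * (t * (s * t))) {g : G} (hg : g ∈ Subgroup.closure {s, t}) :
    g = 1 ∨ g = s ∨ g = t ∨ g = s * t ∨ g = t * s ∨ g = s * (t * s) ∨ g = t * (s * t) ∨
      g = s * (t * (s * t)) := by
  have hs' (a : G) : s * (s * a) = a := by rw [← mul_assoc, hs, one_mul]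
  have ht' (a : G) : t * (t * a) = a := by rw [← mul_assoc, ht, one_mul]
  have hsi : s⁻¹ = s := inv_eq_of_mul_eq_one_left hs
  have hti : t⁻¹ = t := inv_eq_of_mul_eq_one_left ht
  have hlast : t * (s * (t * (s * t))) = s * (t * s) := by rw [← hst, ht']
  induction hg using Subgroup.closure_induction_left with
  | one => exact Or.inl rfl
  | mul_left a ha b hb ih =>
    rcases ha with rfl | rfl <;> rcases ih with rfl | rfl | rfl | rfl | rfl | rfl | rfl | rfl <;>
      simp [*]
  | inv_mul_cancel a ha b hb ih =>
    rcases ha with rfl | rfl <;> rcases ih with rfl | rfl | rfl | rfl | rfl | rfl | rfl | rfl <;>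
      simp [*]

theorem exists_eq_mul_mul_of_mem_closure (hs : s * s = 1) (ht : t * t = 1)
    (htu : t * u * t = u⁻¹) (htr : t * (s * u * s) * t = (s * u * s)⁻¹)
    (hrel : u⁻¹ * (s * u * s) = t * s * u) {g : G} (hg : g ∈ Subgroup.closure {s, t, u}) :
    ∃ d ∈ Subgroup.closure {s, t}, ∃ w ∈ Submonoid.closure {u, s * u * s},
      ∃ e ∈ Subgroup.closure {s, t}, g = d * w * e := by
  set W := Subgroup.closure {s, t} with hW
  have hsW : s ∈ W := Subgroup.subset_closure (by simp)
  have htW : t ∈ W := Subgroup.subset_closure (by simp)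
  have hs' (a : G) : s * (s * a) = a := by rw [← mul_assoc, hs, one_mul]
  have ht' (a : G) : t * (t * a) = a := by rw [← mul_assoc, ht, one_mul]
  have hsi : s⁻¹ = s := inv_eq_of_mul_eq_one_left hs
  have hti : t⁻¹ = t := inv_eq_of_mul_eq_one_left ht
  set r := s * u * s with hr
  set M := Submonoid.closure {u, r} with hM
  have huM : u ∈ M := Submonoid.subset_closure (by simp)
  have hrM : r ∈ M := Submonoid.subset_closure (by simp)
  have hsr : s * r * s = u := by simp [hr, mul_assoc, hs, hs']
  have hrel' : r⁻¹ * u = s * t * r := by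
    have : r⁻¹ * u = s * (u⁻¹ * r) * s := by simp [hr, mul_assoc, hs, hsi]
    rw [this, hrel, hr]
    simp [mul_assoc]
  have hui : t * u⁻¹ * t = u := by rw [← htu]; simp [mul_assoc, ht, ht']
  have hri : t * r⁻¹ * t = r := by rw [← htr]; simp [mul_assoc, ht, ht']
  have hsu' : s * u⁻¹ * s = r⁻¹ := by simp [hr, mul_assoc, hsi]
  have hsr' : s * r⁻¹ * s = u⁻¹ := by rw [← hsu']; simp [mul_assoc, hs, hs']
  have hstep : ∀ a ∈ ({s, t} : Set G), ∀ v ∈ ({u, r, u⁻¹, r⁻¹} : Set G),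
      a * v * a ∈ ({u, r, u⁻¹, r⁻¹} : Set G) := by
    rintro a (rfl | rfl) v (rfl | rfl | rfl | rfl)
    · simp [← hr]
    · simp [hsr]
    · simp [hsu']
    · simp [hsr']
    · simp [htu]
    · simp [htr]
    · simp [hui]
    · simp [hri]
  have hconj : ∀ d ∈ W, ∀ v ∈ ({u, r, u⁻¹, r⁻¹} : Set G),
      d⁻¹ * v * d ∈ ({u, r, u⁻¹, r⁻¹} : Set G) := by
    intro d hd
    have hinv : ∀ a ∈ ({s, t} : Set G), a⁻¹ = a := by rintro a (rfl | rfl) <;> assumption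
    induction hd using Subgroup.closure_induction_left with
    | one => simp
    | mul_left a ha b hb ih =>
      intro v hv
      have := ih _ (hstep a ha v hv)
      rw [mul_inv_rev a b, hinv a ha]
      simpa only [mul_assoc] using this
    | inv_mul_cancel a ha b hb ih =>
      intro v hv
      have := ih _ (hstep a ha v hv)
      rw [mul_inv_rev a⁻¹ b, inv_inv, hinv a ha]
      simpa only [mul_assoc] using this
  have hcases : ∀ w ∈ M, w = 1 ∨ (∃ w' ∈ M, w = u * w') ∨ ∃ w' ∈ M, w = r * w' := by
    intro w hw
    induction hw using Submonoid.closure_induction_left with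
    | one => exact Or.inl rfl
    | mul_left a ha b hb ih =>
      rcases ha with rfl | rfl
      · exact Or.inr (Or.inl ⟨b, hb, rfl⟩)
      · exact Or.inr (Or.inr ⟨b, hb, rfl⟩)
  have hmulM : ∀ v ∈ ({u, r, u⁻¹, r⁻¹} : Set G), ∀ w ∈ M,
      ∃ d ∈ W, ∃ w' ∈ M, ∃ e ∈ W, v * w = d * w' * e := by
    rintro v (rfl | rfl | rfl | rfl) w hw
    · exact ⟨1, one_mem _, _, mul_mem huM hw, 1, one_mem _, by simp⟩
    · exact ⟨1, one_mem _, _, mul_mem hrM hw, 1, one_mem _, by simp⟩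
    · rcases hcases w hw with rfl | ⟨w', hw', rfl⟩ | ⟨w', hw', rfl⟩
      · exact ⟨t, htW, u, huM, t, htW, by simp [htu]⟩
      · exact ⟨1, one_mem _, w', hw', 1, one_mem _, by simp⟩
      · exact ⟨t * s, mul_mem htW hsW, u * w', mul_mem huM hw', 1, one_mem _, by
          rw [← mul_assoc, hrel]; simp [mul_assoc]⟩
    · rcases hcases w hw with rfl | ⟨w', hw', rfl⟩ | ⟨w', hw', rfl⟩
      · exact ⟨t, htW, r, hrM, t, htW, by simp [htr]⟩
      · exact ⟨s * t, mul_mem hsW htW, r * w', mul_mem hrM hw', 1, one_mem _, by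
          rw [← mul_assoc, hrel']; simp [mul_assoc]⟩
      · exact ⟨1, one_mem _, w', hw', 1, one_mem _, by simp⟩
  have hmul : ∀ v ∈ ({u, r, u⁻¹, r⁻¹} : Set G), ∀ d ∈ W, ∀ w ∈ M, ∀ e ∈ W,
      ∃ d' ∈ W, ∃ w' ∈ M, ∃ e' ∈ W, v * (d * w * e) = d' * w' * e' := by
    intro v hv d hd w hw e he
    obtain ⟨d', hd', w', hw', e', he', h⟩ := hmulM _ (hconj d hd v hv) w hw
    refine ⟨d * d', mul_mem hd hd', w', hw', e' * e, mul_mem he' he, ?_⟩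
    calc v * (d * w * e) = d * (d⁻¹ * v * d * w) * e := by group
      _ = _ := by rw [h]; group
  induction hg using Subgroup.closure_induction_left with
  | one => exact ⟨1, one_mem _, 1, one_mem _, 1, one_mem _, by simp⟩
  | mul_left a ha b hb ih =>
    obtain ⟨d, hd, w, hw, e, he, rfl⟩ := ih
    rcases ha with rfl | rfl | rfl
    · exact ⟨_, mul_mem hsW hd, w, hw, e, he, by simp [mul_assoc]⟩
    · exact ⟨_, mul_mem htW hd, w, hw, e, he, by simp [mul_assoc]⟩
    · exact hmul _ (by simp) d hd w hw e he
  | inv_mul_cancel a ha b hb ih =>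
    obtain ⟨d, hd, w, hw, e, he, rfl⟩ := ih
    rcases ha with rfl | rfl | rfl
    · exact ⟨_, mul_mem (inv_mem hsW) hd, w, hw, e, he, by simp [mul_assoc]⟩
    · exact ⟨_, mul_mem (inv_mem htW) hd, w, hw, e, he, by simp [mul_assoc]⟩
    · exact hmul _ (by simp) d hd w hw e he

/-- A group generated by elements satisfying the defining relations of `GL₂(ℤ)` is mapped
injectively to `GL₂(ℤ)`. -/
theorem eq_one_of_map_matrix_eq_one (f : G →* Matrix (Fin 2) (Fin 2) ℤ)
    (hs : s * s = 1) (ht : t * t = 1) (hst : t * (s * (t * s)) = s * (t * (s * t)))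
    (htu : t * u * t = u⁻¹) (htr : t * (s * u * s) * t = (s * u * s)⁻¹)
    (hrel : u⁻¹ * (s * u * s) = t * s * u) (fs : f s = !![0, 1; 1, 0])
    (ft : f t = !![-1, 0; 0, 1]) (fu : f u = !![1, 1; 0, 1]) {g : G}
    (hg : g ∈ Subgroup.closure {s, t, u}) (hfg : f g = 1) : g = 1 := by
  obtain ⟨d, hd, w, hw, e, he, rfl⟩ := exists_eq_mul_mul_of_mem_closure hs ht htu htr hrel hg
  have fr : f (s * u * s) = !![1, 0; 1, 1] := by simp [fs, fu]
  have hpos : (∀ i j, 0 ≤ f w i j) ∧ 1 ≤ f w 0 0 ∧ 1 ≤ f w 1 1 ∧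
      (w = 1 ∨ 3 ≤ f w 0 0 + f w 0 1 + f w 1 0 + f w 1 1) := by
    clear hg hfg
    induction hw using Submonoid.closure_induction_left with
    | one => refine ⟨fun i j => ?_, ?_⟩ <;> [fin_cases i <;> fin_cases j <;> simp; simp]
    | mul_left a ha b hb ih =>
      obtain ⟨h, h0, h1, -⟩ := ih
      have h01 := h 0 1
      have h10 := h 1 0
      rcases ha with rfl | rfl
      · simp only [map_mul f a b, fu, Matrix.mul_apply, Fin.sum_univ_two, Fin.forall_fin_two]
        simp
        omega
      · simp only [map_mul f _ b, fr, Matrix.mul_apply, Fin.sum_univ_two, Fin.forall_fin_two]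
        simp
        omega
  have hfw : f w = f (d⁻¹ * e⁻¹) := by
    have : f (d⁻¹ * (d * w * e) * e⁻¹) = f (d⁻¹ * e⁻¹) := by
      rw [map_mul, map_mul, hfg, mul_one, ← map_mul]
    rwa [show d⁻¹ * (d * w * e) * e⁻¹ = w by group] at this
  have hcase := mem_closure_pair_cases hs ht hst (mul_mem (inv_mem hd) (inv_mem he))
  obtain ⟨-, h00, h11, rfl | h3⟩ := hpos
  · rw [map_one] at hfw
    have : d⁻¹ * e⁻¹ = 1 := by
      generalize d⁻¹ * e⁻¹ = k at hcase hfw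
      rcases hcase with rfl | rfl | rfl | rfl | rfl | rfl | rfl | rfl <;>
        first
        | rfl
        | (have h := congr_fun (congr_fun hfw 0) 0
           have h' := congr_fun (congr_fun hfw 1) 1
           simp [fs, ft] at h h')
    rw [mul_one, ← inv_inj, mul_inv_rev, inv_one]
    rw [inv_mul_eq_one] at this
    simp [this]
  · exfalso
    rw [hfw] at h00 h11 h3
    generalize d⁻¹ * e⁻¹ = k at hcase h00 h11 h3
    rcases hcase with rfl | rfl | rfl | rfl | rfl | rfl | rfl | rfl <;>
      simp [fs, ft] at h00 h11 h3

end GeneratedByElementary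

theorem toAdd_expSum_apply (φ : F2 →* F2) (i : Fin 2) (w : F2) :
    (expSum i (φ w)).toAdd = ∑ k, (expSum i (φ (.of k))).toAdd * (expSum k w).toAdd := by
  have h (v : F2) : expSum i (φ v) =
      ∏ k, (expSum k v) ^ (expSum i (φ (.of k))).toAdd := by
    let ψ : F2 →* Multiplicative ℤ :=
      ∏ k, (zpowGroupHom (expSum i (φ (.of k))).toAdd).comp (expSum k)
    have : (expSum i).comp φ = ψ := by
      refine FreeGroup.ext_hom _ _ fun j => ?_
      fin_cases j <;> apply Multiplicative.toAdd.injective <;> simp [ψ, expSum]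
    simpa [ψ] using DFunLike.congr_fun this v
  rw [h]
  simp

theorem autMat_mul (γ δ : MulAut F2) : autMat (γ * δ) = autMat γ * autMat δ := by
  ext i j
  simp only [autMat, Matrix.of_apply, Matrix.mul_apply, MulAut.mul_apply]
  exact toAdd_expSum_apply γ.toMonoidHom i _

/-- The homomorphism `β̂`. -/
def autMatHom : MulAut F2 →* Matrix (Fin 2) (Fin 2) ℤ where
  toFun := autMat
  map_one' := by
    ext i j
    fin_cases i <;> fin_cases j <;> simp [autMat, expSum]
  map_mul' := autMat_mul

theorem autMat_conj (c : F2) : autMat (MulAut.conj c) = 1 := by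
  ext i j
  fin_cases i <;> fin_cases j <;> simp [autMat, expSum]

theorem autMat_eq (γ : MulAut F2) : autMat γ =
    !![(expSum 0 (γ xg)).toAdd, (expSum 0 (γ yg)).toAdd;
      (expSum 1 (γ xg)).toAdd, (expSum 1 (γ yg)).toAdd] := by
  ext i j
  fin_cases i <;> fin_cases j <;> rfl

@[simp] theorem expSum_zero_xg : expSum 0 xg = Multiplicative.ofAdd 1 := by simp [expSum, xg]
@[simp] theorem expSum_zero_yg : expSum 0 yg = 1 := by simp [expSum, yg]
@[simp] theorem expSum_one_xg : expSum 1 xg = 1 := by simp [expSum, xg]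
@[simp] theorem expSum_one_yg : expSum 1 yg = Multiplicative.ofAdd 1 := by simp [expSum, yg]

instance normal_range_conj {G : Type*} [Group G] : (MulAut.conj : G →* MulAut G).range.Normal where
  conj_mem := by
    rintro _ ⟨c, rfl⟩ γ
    exact ⟨γ c, MulEquiv.ext fun w => by simp⟩

/-- An automorphism of `F₂` acting trivially on the abelianization is inner. -/
theorem exists_eq_conj_of_autMat_eq_one {γ : MulAut F2} (hγ : autMat γ = 1) :
    ∃ c, γ = MulAut.conj c := by
  let I : Subgroup (MulAut F2) := (MulAut.conj : F2 →* MulAut F2).range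
  let π := QuotientGroup.mk' I
  have hI : I ≤ autMatHom.ker := by
    rintro _ ⟨c, rfl⟩
    exact autMat_conj c
  have hπ (a b : MulAut F2) (c : F2) (hx : a xg = c * b xg * c⁻¹) (hy : a yg = c * b yg * c⁻¹) :
      π a = π b := by
    have hc : π (MulAut.conj c) = 1 := (QuotientGroup.eq_one_iff _).mpr ⟨c, rfl⟩
    rw [F2.aut_ext (γ := a) (δ := MulAut.conj c * b) hx hy, map_mul, hc, one_mul]
  have hmem : γ ∈ (Subgroup.closure {π swapAut, π invAut, π shearAut}).comap π := by
    refine mem_of_elementary_mem ?_ ?_ ?_ (fun c => ?_) γ <;> rw [Subgroup.mem_comap]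
    · exact Subgroup.subset_closure (by simp)
    · exact Subgroup.subset_closure (by simp)
    · exact Subgroup.subset_closure (by simp)
    · rw [hπ (MulAut.conj c) 1 c rfl rfl, map_one]
      exact one_mem _
  have h1 : π γ = 1 := by
    refine eq_one_of_map_matrix_eq_one (QuotientGroup.lift I autMatHom hI) ?_ ?_ ?_ ?_ ?_ ?_
      ?_ ?_ ?_ hmem hγ
    · rw [← map_mul]
      exact (hπ _ 1 1 (by simp) (by simp)).trans (map_one π)
    · rw [← map_mul]
      exact (hπ _ 1 1 (by simp) (by simp)).trans (map_one π)
    · simp only [← map_mul]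
      exact hπ _ _ 1 (by simp) (by simp)
    · rw [eq_inv_iff_mul_eq_one]
      simp only [← map_mul]
      exact (hπ _ 1 1 (by simp) (by simp)).trans (map_one π)
    · rw [eq_inv_iff_mul_eq_one]
      simp only [← map_mul]
      exact (hπ _ 1 yg (by simp [mul_assoc]) (by simp)).trans (map_one π)
    · rw [inv_mul_eq_iff_eq_mul]
      simp only [← map_mul]
      exact hπ _ _ xg⁻¹ (by simp [mul_assoc]) (by simp [mul_assoc])
    · change autMat swapAut = _
      simp [autMat_eq]
    · change autMat invAut = _
      simp [autMat_eq]
    · change autMat shearAut = _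
      simp [autMat_eq]
  obtain ⟨c, hc⟩ := (QuotientGroup.eq_one_iff _).mp h1
  exact ⟨c, hc.symm⟩

/-- The permutation `inl k ↦ inl (k + 1)` of `ℤ ⊕ ℤ`. -/
def xPerm : Equiv.Perm (ℤ ⊕ ℤ) := Equiv.sumCongr (Equiv.addRight 1) (Equiv.refl ℤ)

/-- The involution of `ℤ ⊕ ℤ` exchanging `inl (3 * k)` and `inr k`. -/
def yPerm : Equiv.Perm (ℤ ⊕ ℤ) :=
  Function.Involutive.toPerm
    (Sum.elim (fun a => if 3 ∣ a then .inr (a / 3) else .inl a) fun k => .inl (3 * k)) <| by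
      rintro (a | k)
      · by_cases h : (3 : ℤ) ∣ a <;> simp [h, Int.mul_ediv_cancel']
      · simp

/-- The action of `F₂` on the squares of the infinite origami corresponding to `ker α`. -/
def squarePerm : F2 →* Equiv.Perm (ℤ ⊕ ℤ) := FreeGroup.lift ![xPerm, yPerm]

@[simp] theorem squarePerm_xg : squarePerm xg = xPerm := by simp [squarePerm, xg]
@[simp] theorem squarePerm_yg : squarePerm yg = yPerm := by simp [squarePerm, yg]

@[simp] theorem xPerm_inl (a : ℤ) : xPerm (.inl a) = .inl (a + 1) := rfl
@[simp] theorem xPerm_inr (a : ℤ) : xPerm (.inr a) = .inr a := rfl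
@[simp] theorem xPerm_symm_inl (a : ℤ) : xPerm.symm (.inl a) = .inl (a - 1) := rfl
@[simp] theorem xPerm_symm_inr (a : ℤ) : xPerm.symm (.inr a) = .inr a := rfl
@[simp] theorem yPerm_symm : yPerm.symm = yPerm := rfl
@[simp] theorem yPerm_inr (a : ℤ) : yPerm (.inr a) = .inl (3 * a) := rfl
@[simp] theorem yPerm_inl_three_mul (a : ℤ) : yPerm (.inl (3 * a)) = .inr a := by
  change (if 3 ∣ 3 * a then _ else _) = _
  simp
theorem yPerm_inl_of_not_dvd {a : ℤ} (h : ¬ 3 ∣ a) : yPerm (.inl a) = .inl a := if_neg h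

@[simp] theorem yPerm_yPerm (p : ℤ ⊕ ℤ) : yPerm (yPerm p) = p := yPerm.apply_symm_apply p

@[simp] theorem xPerm_zpow_inl (s a : ℤ) : (xPerm ^ s) (.inl a) = .inl (a + s) := by
  induction s generalizing a with
  | zero => simp
  | succ i ih => rw [zpow_add_one, Equiv.Perm.mul_apply, xPerm_inl, ih]; congr 1; ring
  | pred i ih =>
    rw [zpow_sub_one, Equiv.Perm.mul_apply, Equiv.Perm.inv_def, xPerm_symm_inl, ih]
    congr 1
    ring

@[simp] theorem xPerm_zpow_inr (s a : ℤ) : (xPerm ^ s) (.inr a) = .inr a := by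
  induction s with
  | zero => simp
  | succ i ih => rw [zpow_add_one, Equiv.Perm.mul_apply, xPerm_inr, ih]
  | pred i ih => rw [zpow_sub_one, Equiv.Perm.mul_apply, Equiv.Perm.inv_def, xPerm_symm_inr, ih]

theorem squarePerm_of_mem_UL (α : UL →* Multiplicative ℤ)
    (hα1 : ∀ hm : xg ^ 3 ∈ UL, α ⟨xg ^ 3, hm⟩ = Multiplicative.ofAdd 1)
    (hα2 : ∀ hm : xg * yg * xg⁻¹ ∈ UL, α ⟨xg * yg * xg⁻¹, hm⟩ = 1)
    (hα3 : ∀ hm : xg ^ 2 * yg * (xg ^ 2)⁻¹ ∈ UL, α ⟨xg ^ 2 * yg * (xg ^ 2)⁻¹, hm⟩ = 1)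
    (hα4 : ∀ hm : yg * xg * yg⁻¹ ∈ UL, α ⟨yg * xg * yg⁻¹, hm⟩ = 1)
    (hα5 : ∀ hm : yg ^ 2 ∈ UL, α ⟨yg ^ 2, hm⟩ = 1) {u : F2} (hu : u ∈ UL) (k : ℤ) :
    squarePerm u (.inl (3 * k)) = .inl (3 * (k + (α ⟨u, hu⟩).toAdd)) := by
  have h1 : xg ^ 3 ∈ UL := Subgroup.subset_closure (by simp)
  have h2 : xg * yg * xg⁻¹ ∈ UL := Subgroup.subset_closure (by simp)
  have h3 : xg ^ 2 * yg * (xg ^ 2)⁻¹ ∈ UL := Subgroup.subset_closure (by simp)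
  have h4 : yg * xg * yg⁻¹ ∈ UL := Subgroup.subset_closure (by simp)
  have h5 : yg ^ 2 ∈ UL := Subgroup.subset_closure (by simp)
  suffices h : ∃ hu : u ∈ UL, ∀ k : ℤ,
      squarePerm u (.inl (3 * k)) = .inl (3 * (k + (α ⟨u, hu⟩).toAdd)) from h.2 k
  refine Subgroup.closure_induction (p := fun u _ => ∃ hu : u ∈ UL, ∀ k : ℤ,
    squarePerm u (.inl (3 * k)) = .inl (3 * (k + (α ⟨u, hu⟩).toAdd))) ?_ ?_ ?_ ?_ hu
  · rintro v (rfl | rfl | rfl | rfl | rfl)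
    · refine ⟨h1, fun k => ?_⟩
      rw [hα1]
      simp [pow_succ, mul_add, add_assoc]
    · refine ⟨h2, fun k => ?_⟩
      rw [hα2]
      have : ¬ (3 : ℤ) ∣ 3 * k - 1 := by omega
      simp [yPerm_inl_of_not_dvd this]
    · refine ⟨h3, fun k => ?_⟩
      rw [hα3]
      have : ¬ (3 : ℤ) ∣ 3 * k - 1 - 1 := by omega
      simp [pow_succ, yPerm_inl_of_not_dvd this]
    · refine ⟨h4, fun k => ?_⟩
      rw [hα4]
      simp
    · refine ⟨h5, fun k => ?_⟩
      rw [hα5]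
      simp [pow_succ]
  · refine ⟨one_mem _, fun k => ?_⟩
    rw [show (⟨1, one_mem _⟩ : UL) = 1 from rfl]
    simp
  · rintro a b - - ⟨ha, iha⟩ ⟨hb, ihb⟩
    refine ⟨mul_mem ha hb, fun k => ?_⟩
    rw [show (⟨a * b, _⟩ : UL) = ⟨a, ha⟩ * ⟨b, hb⟩ from rfl, map_mul, map_mul,
      Equiv.Perm.mul_apply, ihb, iha, toAdd_mul]
    congr 1
    ring
  · rintro a - ⟨ha, iha⟩
    refine ⟨inv_mem ha, fun k => ?_⟩
    rw [show (⟨a⁻¹, _⟩ : UL) = ⟨a, ha⟩⁻¹ from rfl, map_inv, map_inv, Equiv.Perm.inv_eq_iff_eq,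
      iha, toAdd_inv]
    congr 1
    ring

theorem exists_eq_mul_mem_UL (w : F2) :
    ∃ t ∈ ({1, xg, xg ^ 2, yg} : Set F2), ∃ u ∈ UL, w = t * u := by
  have h1 : xg ^ 3 ∈ UL := Subgroup.subset_closure (by simp)
  have h2 : xg * yg * xg⁻¹ ∈ UL := Subgroup.subset_closure (by simp)
  have h3 : xg ^ 2 * yg * (xg ^ 2)⁻¹ ∈ UL := Subgroup.subset_closure (by simp)
  have h4 : yg * xg * yg⁻¹ ∈ UL := Subgroup.subset_closure (by simp)
  have h5 : yg ^ 2 ∈ UL := Subgroup.subset_closure (by simp)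
  have h2' : (xg ^ 2)⁻¹ * yg * xg ^ 2 ∈ UL := by
    convert mul_mem (mul_mem (inv_mem h1) h2) h1 using 1
    group
  have h3' : xg⁻¹ * yg * xg ∈ UL := by
    convert mul_mem (mul_mem (inv_mem h1) h3) h1 using 1
    group
  have h4' : yg⁻¹ * xg * yg ∈ UL := by
    convert mul_mem (mul_mem (inv_mem h5) h4) h5 using 1
    group
  have hmem : w ∈ Subgroup.closure {xg, yg} := by
    have : Subgroup.closure {xg, yg} = ⊤ := by
      rw [← FreeGroup.closure_range_of (Fin 2)]
      congr 1
      ext v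
      simp [xg, yg, eq_comm]
    rw [this]
    trivial
  have mk (v t u u' : F2) (ht : t ∈ ({1, xg, xg ^ 2, yg} : Set F2)) (hu' : u' ∈ UL) (hu : u ∈ UL)
      (h : v = t * u') : ∃ t ∈ ({1, xg, xg ^ 2, yg} : Set F2), ∃ w ∈ UL, v * u = t * w :=
    ⟨t, ht, u' * u, mul_mem hu' hu, by rw [h, mul_assoc]⟩
  induction hmem using Subgroup.closure_induction_left with
  | one => exact ⟨1, by simp, 1, one_mem _, by simp⟩
  | mul_left a ha b hb ih =>
    obtain ⟨t, ht, u, hu, rfl⟩ := ih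
    rw [← mul_assoc]
    rcases ha with rfl | rfl <;> rcases ht with rfl | rfl | rfl | rfl
    · exact mk _ xg _ 1 (by simp) (one_mem _) hu (by group)
    · exact mk _ (xg ^ 2) _ 1 (by simp) (one_mem _) hu (by rw [mul_one, pow_two])
    · exact mk _ 1 _ _ (by simp) h1 hu (by group)
    · exact mk _ yg _ _ (by simp) h4' hu (by group)
    · exact mk _ yg _ 1 (by simp) (one_mem _) hu (by group)
    · exact mk _ xg _ _ (by simp) h3' hu (by group)
    · exact mk _ (xg ^ 2) _ _ (by simp) h2' hu (by group)
    · exact mk _ 1 _ _ (by simp) h5 hu (by rw [one_mul, pow_two])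
  | inv_mul_cancel a ha b hb ih =>
    obtain ⟨t, ht, u, hu, rfl⟩ := ih
    rw [← mul_assoc]
    rcases ha with rfl | rfl <;> rcases ht with rfl | rfl | rfl | rfl
    · exact mk _ (xg ^ 2) _ _ (by simp) (inv_mem h1) hu (by group)
    · exact mk _ 1 _ 1 (by simp) (one_mem _) hu (by group)
    · exact mk _ xg _ 1 (by simp) (one_mem _) hu (by group)
    · exact mk _ yg _ _ (by simp) (inv_mem h4') hu (by group)
    · exact mk _ yg _ _ (by simp) (inv_mem h5) hu (by group)
    · exact mk _ xg _ _ (by simp) (inv_mem h3') hu (by group)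
    · exact mk _ (xg ^ 2) _ _ (by simp) (inv_mem h2') hu (by group)
    · exact mk _ 1 _ 1 (by simp) (one_mem _) hu (by group)

theorem mem_Hgrp_iff {α : UL →* Multiplicative ℤ}
    (hα : ∀ u (hu : u ∈ UL) (k : ℤ),
      squarePerm u (.inl (3 * k)) = .inl (3 * (k + (α ⟨u, hu⟩).toAdd))) {n : ℕ} {w : F2} :
    w ∈ Hgrp α n ↔ ∃ m : ℤ, squarePerm w (.inl 0) = .inl (3 * n * m) := by
  constructor
  · rintro ⟨⟨u, hu⟩, ⟨m, hm⟩, rfl⟩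
    refine ⟨m, ?_⟩
    have := hα u hu 0
    rw [hm] at this
    simpa [mul_assoc] using this
  · rintro ⟨m, hm⟩
    obtain ⟨t, ht, u, hu, rfl⟩ := exists_eq_mul_mem_UL w
    have h0 := hα u hu 0
    rw [mul_zero] at h0
    rw [map_mul, Equiv.Perm.mul_apply, h0, mul_assoc] at hm
    rcases ht with rfl | rfl | rfl | rfl
    · rw [map_one, Equiv.Perm.one_apply, Sum.inl.injEq] at hm
      rw [one_mul]
      exact ⟨⟨u, hu⟩, ⟨m, by linarith⟩, rfl⟩
    · rw [squarePerm_xg, xPerm_inl, Sum.inl.injEq] at hm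
      omega
    · rw [map_pow, squarePerm_xg, pow_two, Equiv.Perm.mul_apply, xPerm_inl, xPerm_inl,
        Sum.inl.injEq] at hm
      omega
    · rw [squarePerm_yg, yPerm_inl_three_mul] at hm
      cases hm

@[simp] theorem shearAut_zpow_xg (s : ℤ) : (shearAut ^ s) xg = xg := by
  have : shearAut ∈ MulAction.stabilizer (MulAut F2) xg := shearAut_xg
  exact zpow_mem this s

@[simp] theorem shearAut_inv_yg : shearAut⁻¹ yg = xg⁻¹ * yg := by
  apply shearAut.injective
  rw [MulAut.apply_inv_self]
  simp

@[simp] theorem shearAut_zpow_yg (s : ℤ) : (shearAut ^ s) yg = xg ^ s * yg := by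
  induction s with
  | zero => simp
  | succ i ih =>
    rw [zpow_add_one, MulAut.mul_apply, shearAut_yg, map_mul, ih, shearAut_zpow_xg]
    group
  | pred i ih =>
    rw [zpow_sub_one, MulAut.mul_apply, shearAut_inv_yg, map_mul, ih, map_inv, shearAut_zpow_xg]
    group

theorem autMat_shearAut_zpow (s : ℤ) : autMat (shearAut ^ s) = !![1, s; 0, 1] := by
  simp [autMat_eq]

/-- The orbit relation of the translations by `n` along the infinite origami. -/
def squareRel (n : ℤ) : ℤ ⊕ ℤ → ℤ ⊕ ℤ → Prop :=
  Sum.LiftRel (fun a b => 3 * n ∣ a - b) fun a b => n ∣ a - b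

theorem squareRel_trans {n : ℤ} {p q r : ℤ ⊕ ℤ} (h : squareRel n p q) (h' : squareRel n q r) :
    squareRel n p r := by
  rcases h with h | h <;> rcases h' with h' | h'
  · exact .inl (by simpa using dvd_add h h')
  · exact .inr (by simpa using dvd_add h h')

theorem squareRel_symm {n : ℤ} {p q : ℤ ⊕ ℤ} (h : squareRel n p q) : squareRel n q p := by
  cases h <;> constructor <;> rename_i h <;> rwa [dvd_sub_comm]

theorem squareRel_yPerm {n : ℤ} {p q : ℤ ⊕ ℤ} (h : squareRel n p q) :
    squareRel n (yPerm p) (yPerm q) := by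
  rcases h with @⟨a, b, h⟩ | @⟨a, b, h⟩
  · have h3 : (3 : ℤ) ∣ a - b := dvd_of_mul_right_dvd h
    by_cases ha : (3 : ℤ) ∣ a
    · have hb : (3 : ℤ) ∣ b := by omega
      obtain ⟨a, rfl⟩ := ha
      obtain ⟨b, rfl⟩ := hb
      rw [← mul_sub, mul_dvd_mul_iff_left (by norm_num)] at h
      simpa [squareRel] using h
    · have hb : ¬ (3 : ℤ) ∣ b := by omega
      rw [yPerm_inl_of_not_dvd ha, yPerm_inl_of_not_dvd hb]
      exact .inl h
  · simpa [squareRel, ← mul_sub] using mul_dvd_mul_left 3 h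

theorem squareRel_yPerm_iff {n : ℤ} {p q : ℤ ⊕ ℤ} :
    squareRel n (yPerm p) (yPerm q) ↔ squareRel n p q :=
  ⟨fun h => by simpa using squareRel_yPerm h, squareRel_yPerm⟩

theorem squareRel_xPerm_iff {n : ℤ} {p q : ℤ ⊕ ℤ} :
    squareRel n (xPerm p) (xPerm q) ↔ squareRel n p q := by
  rcases p with a | a <;> rcases q with b | b <;> simp [squareRel]

theorem squareRel_xPerm_zpow_iff {n s : ℤ} (hs : 3 * n ∣ s) {p q : ℤ ⊕ ℤ} :
    squareRel n ((xPerm ^ s) p) q ↔ squareRel n p q := by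
  rcases p with a | a <;> rcases q with b | b <;> simp [squareRel]
  rw [add_sub_right_comm, dvd_add_left hs]

theorem squareRel_shearAut_zpow_iff {n s : ℤ} (hs : 3 * n ∣ s) (w : F2) (p q : ℤ ⊕ ℤ) :
    squareRel n (squarePerm ((shearAut ^ s) w) p) (squarePerm w q) ↔ squareRel n p q := by
  induction w using FreeGroup.induction_on generalizing p q with
  | C1 => simp
  | of i =>
    fin_cases i
    · change squareRel n (squarePerm ((shearAut ^ s) xg) p) (squarePerm xg q) ↔ _
      simp [squareRel_xPerm_iff]
    · change squareRel n (squarePerm ((shearAut ^ s) yg) p) (squarePerm yg q) ↔ _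
      simp [squareRel_xPerm_zpow_iff hs, squareRel_yPerm_iff]
  | inv_of i ih =>
    rw [← ih]
    simp
  | mul a b iha ihb =>
    simp only [map_mul, Equiv.Perm.mul_apply, iha, ihb]

theorem mem_Hgrp_iff_squareRel {α : UL →* Multiplicative ℤ}
    (hα : ∀ u (hu : u ∈ UL) (k : ℤ),
      squarePerm u (.inl (3 * k)) = .inl (3 * (k + (α ⟨u, hu⟩).toAdd))) {n : ℕ} {w : F2} :
    w ∈ Hgrp α n ↔ squareRel n (squarePerm w (.inl 0)) (.inl 0) := by
  rw [mem_Hgrp_iff hα]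
  rcases squarePerm w (.inl 0) with a | a <;> simp [squareRel, Dvd.dvd]

theorem map_shearAut_zpow_Hgrp {α : UL →* Multiplicative ℤ}
    (hα : ∀ u (hu : u ∈ UL) (k : ℤ),
      squarePerm u (.inl (3 * k)) = .inl (3 * (k + (α ⟨u, hu⟩).toAdd))) {n : ℕ} {s : ℤ}
    (hs : 3 * (n : ℤ) ∣ s) :
    Subgroup.map (shearAut ^ s).toMonoidHom (Hgrp α n) = Hgrp α n := by
  have key (w : F2) : (shearAut ^ s) w ∈ Hgrp α n ↔ w ∈ Hgrp α n := by
    have h := (squareRel_shearAut_zpow_iff hs w (.inl 0) (.inl 0)).mpr (.inl (by simp))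
    rw [mem_Hgrp_iff_squareRel hα, mem_Hgrp_iff_squareRel hα]
    exact ⟨squareRel_trans (squareRel_symm h), squareRel_trans h⟩
  ext w
  constructor
  · rintro ⟨v, hv, rfl⟩
    exact (key v).mpr hv
  · intro hw
    refine ⟨(shearAut ^ s)⁻¹ w, (key _).mp ?_, ?_⟩
    · rwa [MulAut.apply_inv_self]
    · exact MulAut.apply_inv_self _ _ _

theorem dvd_of_map_Hgrp_eq {α : UL →* Multiplicative ℤ}
    (hα : ∀ u (hu : u ∈ UL) (k : ℤ),
      squarePerm u (.inl (3 * k)) = .inl (3 * (k + (α ⟨u, hu⟩).toAdd))) {n : ℕ} {s : ℤ}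
    {γ : MulAut F2} (hγ : autMat γ = !![1, s; 0, 1])
    (hmap : Subgroup.map γ.toMonoidHom (Hgrp α n) = Hgrp α n) : 3 * (n : ℤ) ∣ s := by
  obtain ⟨c, hc⟩ := exists_eq_conj_of_autMat_eq_one (γ := γ * (shearAut ^ s)⁻¹) (by
    have h1 : autMat (shearAut ^ s * (shearAut ^ s)⁻¹) = 1 := by
      rw [mul_inv_cancel]
      exact map_one autMatHom
    rwa [autMat_mul, autMat_shearAut_zpow, ← hγ, ← autMat_mul] at h1)
  rw [mul_inv_eq_iff_eq_mul] at hc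
  have hy : γ yg = c * (xg ^ s * yg) * c⁻¹ := by
    rw [hc, MulAut.mul_apply, shearAut_zpow_yg, MulAut.conj_apply]
  have hg (g : F2) : g * yg ^ 2 * g⁻¹ ∈ Hgrp α n := by
    rw [mem_Hgrp_iff hα]
    exact ⟨0, by simp [pow_two]⟩
  have hmem : (xg ^ s * yg) ^ 2 ∈ Hgrp α n := by
    rw [← hmap]
    refine ⟨_, hg (γ⁻¹ c⁻¹), ?_⟩
    change γ _ = _
    simp only [map_mul, map_inv, hy, MulAut.apply_inv_self, pow_two]
    group
  rw [mem_Hgrp_iff hα] at hmem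
  obtain ⟨m, hm⟩ := hmem
  have h0 : yPerm (.inl 0) = .inr 0 := yPerm_inl_three_mul 0
  simp [pow_two, h0] at hm
  exact ⟨m, hm⟩

/-- For the subgroups `Hₙ` built from `U_L` as in Setting A: for every `n ≥ 1` and every
integer `s`, the matrix `[[1,s],[0,1]]` lies in `Γ(Hₙ)` iff `3n ∣ s`. -/
theorem UL_parabolic_mem_veech_Hn_iff
    (α : UL →* Multiplicative ℤ)
    (hα1 : ∀ hm : xg ^ 3 ∈ UL, α ⟨xg ^ 3, hm⟩ = Multiplicative.ofAdd 1)
    (hα2 : ∀ hm : xg * yg * xg⁻¹ ∈ UL, α ⟨xg * yg * xg⁻¹, hm⟩ = 1)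
    (hα3 : ∀ hm : xg ^ 2 * yg * (xg ^ 2)⁻¹ ∈ UL, α ⟨xg ^ 2 * yg * (xg ^ 2)⁻¹, hm⟩ = 1)
    (hα4 : ∀ hm : yg * xg * yg⁻¹ ∈ UL, α ⟨yg * xg * yg⁻¹, hm⟩ = 1)
    (hα5 : ∀ hm : yg ^ 2 ∈ UL, α ⟨yg ^ 2, hm⟩ = 1)
    : ∀ n : ℕ, 1 ≤ n → ∀ s : ℤ,
      ((⟨!![1, s; 0, 1], by simp [Matrix.det_fin_two_of]⟩ : SL2Z) ∈
        VeechGroup (Hgrp α n)) ↔ (3 * (n : ℤ)) ∣ s := by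
  have hα := fun u (hu : u ∈ UL) => squarePerm_of_mem_UL α hα1 hα2 hα3 hα4 hα5 hu
  intro n _ s
  constructor
  · rintro ⟨γ, ⟨-, hmap⟩, hγ⟩
    exact dvd_of_map_Hgrp_eq hα hγ.symm hmap
  · intro hs
    refine ⟨shearAut ^ s, ⟨?_, map_shearAut_zpow_Hgrp hα hs⟩, (autMat_shearAut_zpow s).symm⟩
    rw [autMat_shearAut_zpow]
    simp
end
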